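/- arXiv:1708.06165 — 6 statements merged into one kernel-verified Lean document; each statement's English description precedes it below -/
import Mathlib

section
/- The multi-bang integrand g is linearly bounded from above and below: for all t ∈ ℝ, ½·u_2·|t| ≤ g(t) ≤ u_m·|t|. -/
/-- A point between `u 1` and `u m` lies in one of the consecutive intervals `[u i, u (i + 1)]`. -/
theorem exists_mem_Icc_succ {α : Type*} [LinearOrder α] (u : ℕ → α) {m : ℕ} (hm : 2 ≤ m) {t : α}
    (h1 : u 1 ≤ t) (ht : t ≤ u m) : ∃ i, 1 ≤ i ∧ i < m ∧ t ∈ Set.Icc (u i) (u (i + 1)) := by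
  induction m, hm using Nat.le_induction with
  | base => exact ⟨1, le_rfl, one_lt_two, h1, ht⟩
  | succ k hk ih =>
    rcases le_total t (u k) with h | h
    · obtain ⟨i, hi, him, hit⟩ := ih h
      exact ⟨i, hi, him.trans k.lt_succ_self, hit⟩
    · exact ⟨k, by lia, k.lt_succ_self, h, ht⟩

/-- The multi-bang integrand `g` is linearly bounded from above and below:
`½·u₂·|t| ≤ g t ≤ u_m·|t|` for all `t`. -/
theorem multibang_linear_bounds
    (m : ℕ) (hm : 2 ≤ m) (u : ℕ → ℝ) (hu1 : u 1 = 0)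
    (humono : ∀ i, 1 ≤ i → i < m → u i < u (i + 1))
    (g : ℝ → ℝ)
    (hg1 : ∀ t ≤ (0 : ℝ), g t = -(u m) * t)
    (hg2 : ∀ i, 1 ≤ i → i < m →
      ∀ t ∈ Set.Icc (u i) (u (i + 1)),
        g t = ((u i + u (i + 1)) * t - u i * u (i + 1)) / 2)
    (hg3 : ∀ t ≥ u m, g t = u m * t - u m ^ 2 / 2) :
    ∀ t : ℝ, u 2 / 2 * |t| ≤ g t ∧ g t ≤ u m * |t| := by
  have mono : ∀ i j, 1 ≤ i → i ≤ j → j ≤ m → u i ≤ u j := by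
    intro i j hi hij
    induction j, hij using Nat.le_induction with
    | base => exact fun _ => le_rfl
    | succ k hk ih => exact fun hkm => (ih (by lia)).trans (humono k (by lia) (by lia)).le
  have h2 : 0 < u 2 := hu1 ▸ humono 1 le_rfl (by lia)
  have h2m : u 2 ≤ u m := mono 2 m (by lia) hm le_rfl
  intro t
  rcases le_total t 0 with ht | ht
  · rw [hg1 t ht, abs_of_nonpos ht]
    constructor <;> nlinarith
  rw [abs_of_nonneg ht]
  rcases le_total (u m) t with htm | htm
  · rw [hg3 t htm]
    constructor <;> nlinarith
  obtain ⟨i, hi, him, hit⟩ := exists_mem_Icc_succ u hm (hu1.trans_le ht) htm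
  have ha : 0 ≤ u i := hu1 ▸ mono 1 i le_rfl hi him.le
  have hab : u i < u (i + 1) := humono i hi him
  have hbm : u (i + 1) ≤ u m := mono (i + 1) m (by lia) him le_rfl
  rw [hg2 i hi him t hit]
  constructor
  · rcases hi.eq_or_lt with rfl | hi
    · rw [hu1]
      norm_num
      linarith
    · have h2i : u 2 ≤ u i := mono 2 i (by lia) hi him.le
      nlinarith [mul_nonneg (sub_nonneg.2 h2i) ht,
        mul_nonneg (ha.trans hab.le) (sub_nonneg.2 hit.1)]
  · nlinarith [mul_nonneg ha (ha.trans hab.le), mul_nonneg (sub_nonneg.2 hbm) ht,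
      mul_nonneg (sub_nonneg.2 (hab.le.trans hbm)) ht]
end

section
/- The subdifferential of the multi-bang integrand g is given pointwise by: ∂g(t) = {−u_m} if t < 0; ∂g(0) = [−u_m, ½(u_1+u_2)]; ∂g(t) = {½(u_i+u_{i+1})} if t ∈ (u_i, u_{i+1}) for some 1 ≤ i < m; ∂g(u_i) = [½(u_{i−1}+u_i), ½(u_i+u_{i+1})] for 1 < i < m; ∂g(u_m) = [½(u_{m−1}+u_m), u_m]; and ∂g(t) = {u_m} if t > u_m. -/
/-- The set of subgradients of a function `f : ℝ → ℝ` at a point `t`. -/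
def subgrad (f : ℝ → ℝ) (t : ℝ) : Set ℝ :=
  {s : ℝ | ∀ t' : ℝ, f t + s * (t' - t) ≤ f t'}

/-- If both one-sided affine pieces of `f` at `t`, of slopes `a` and `b`, extend to global
minorants of `f`, then the subgradients of `f` at `t` are exactly the slopes in `[a, b]`. -/
theorem subgrad_eq_Icc {f : ℝ → ℝ} {t a b c d : ℝ} (hct : c < t) (htd : t < d)
    (hc : f c = f t + a * (c - t)) (hd : f d = f t + b * (d - t))
    (ha : ∀ x, f t + a * (x - t) ≤ f x) (hb : ∀ x, f t + b * (x - t) ≤ f x) :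
    subgrad f t = Set.Icc a b := by
  ext s
  constructor
  · intro hs
    have hsc := hs c
    have hsd := hs d
    constructor <;> nlinarith
  · rintro ⟨has, hsb⟩ x
    rcases le_total x t with hx | hx
    · nlinarith [ha x]
    · nlinarith [hb x]

theorem le_of_step_lt {m : ℕ} {u : ℕ → ℝ} (humono : ∀ i, 1 ≤ i → i < m → u i < u (i + 1))
    {i j : ℕ} (hi : 1 ≤ i) (hij : i ≤ j) (hj : j ≤ m) : u i ≤ u j := by
  induction j, hij using Nat.le_induction with
  | base => exact le_rfl
  | succ k hk ih => exact (ih (by omega)).trans (humono k (by omega) (by omega)).le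

/-- The intervals between consecutive nodes cover the range between the extreme nodes. -/
theorem exists_mem_Icc_nodes {m : ℕ} {u : ℕ → ℝ} {t : ℝ} (hm : 1 ≤ m) (h1 : u 1 ≤ t)
    (ht : t < u m) : ∃ i, 1 ≤ i ∧ i < m ∧ t ∈ Set.Icc (u i) (u (i + 1)) := by
  induction m, hm using Nat.le_induction with
  | base => exact absurd h1 ht.not_ge
  | succ k hk ih =>
    rcases lt_or_ge t (u k) with h | h
    · obtain ⟨i, hi, hik, hti⟩ := ih h
      exact ⟨i, hi, by omega, hti⟩
    · exact ⟨k, hk, by omega, h, ht.le⟩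

/-- Pointwise characterization of the subdifferential of the multi-bang
integrand `g`. -/
theorem multibang_subdifferential
    (m : ℕ) (hm : 2 ≤ m) (u : ℕ → ℝ) (hu1 : u 1 = 0)
    (humono : ∀ i, 1 ≤ i → i < m → u i < u (i + 1))
    (g : ℝ → ℝ)
    (hg1 : ∀ t ≤ (0 : ℝ), g t = -(u m) * t)
    (hg2 : ∀ i, 1 ≤ i → i < m →
      ∀ t ∈ Set.Icc (u i) (u (i + 1)),
        g t = ((u i + u (i + 1)) * t - u i * u (i + 1)) / 2)
    (hg3 : ∀ t ≥ u m, g t = u m * t - u m ^ 2 / 2) :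
    (∀ t : ℝ, t < 0 → subgrad g t = {-(u m)}) ∧
    subgrad g 0 = Set.Icc (-(u m)) ((u 1 + u 2) / 2) ∧
    (∀ i, 1 ≤ i → i < m → ∀ t ∈ Set.Ioo (u i) (u (i + 1)),
      subgrad g t = {(u i + u (i + 1)) / 2}) ∧
    (∀ i, 1 < i → i < m →
      subgrad g (u i) = Set.Icc ((u (i - 1) + u i) / 2) ((u i + u (i + 1)) / 2)) ∧
    subgrad g (u m) = Set.Icc ((u (m - 1) + u m) / 2) (u m) ∧
    (∀ t : ℝ, u m < t → subgrad g t = {u m}) := by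
  have hmono : ∀ i j, 1 ≤ i → i ≤ j → j ≤ m → u i ≤ u j :=
    fun i j hi hij hj => le_of_step_lt humono hi hij hj
  have hnonneg : ∀ i, 1 ≤ i → i ≤ m → 0 ≤ u i :=
    fun i hi him => hu1 ▸ hmono 1 i le_rfl hi him
  have hpos : 0 < u m := hu1 ▸
    (humono 1 le_rfl (by omega)).trans_le (hmono 2 m (by omega) hm le_rfl)
  have hcases : ∀ t, t ≤ 0 ∨ u m ≤ t ∨
      ∃ i, 1 ≤ i ∧ i < m ∧ t ∈ Set.Icc (u i) (u (i + 1)) := by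
    intro t
    rcases le_total t 0 with h | h
    · exact Or.inl h
    rcases le_or_gt (u m) t with h' | h'
    · exact Or.inr (Or.inl h')
    · exact Or.inr (Or.inr (exists_mem_Icc_nodes (by omega) (hu1 ▸ h) h'))
  have hsq : ∀ i, 1 ≤ i → i < m → ∀ t ∈ Set.Icc (u i) (u (i + 1)), t ^ 2 / 2 ≤ g t := by
    intro i hi him t ht
    rw [hg2 i hi him t ht]
    nlinarith [mul_nonneg (sub_nonneg.2 ht.1) (sub_nonneg.2 ht.2)]
  have hleft : ∀ t, -(u m) * t ≤ g t := by
    intro t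
    rcases hcases t with h | h | ⟨i, hi, him, ht⟩
    · exact (hg1 t h).ge
    · rw [hg3 t h]
      nlinarith
    · nlinarith [hsq i hi him t ht, hnonneg i hi him.le, ht.1]
  have hright : ∀ t, u m * t - u m ^ 2 / 2 ≤ g t := by
    intro t
    rcases hcases t with h | h | ⟨i, hi, him, ht⟩
    · rw [hg1 t h]
      nlinarith
    · exact (hg3 t h).ge
    · nlinarith [hsq i hi him t ht, sq_nonneg (t - u m)]
  have hmid : ∀ j, 1 ≤ j → j < m → ∀ t,
      ((u j + u (j + 1)) * t - u j * u (j + 1)) / 2 ≤ g t := by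
    intro j hj hjm t
    have hj0 := hnonneg j hj hjm.le
    have hj1 := hnonneg (j + 1) (by omega) hjm
    have hjm' := hmono j m hj hjm.le le_rfl
    have hjm1 := hmono (j + 1) m (by omega) hjm le_rfl
    rcases hcases t with h | h | ⟨i, hi, him, ht⟩
    · rw [hg1 t h]
      nlinarith [mul_nonneg hj0 hj1, mul_nonneg (add_nonneg hj0 hj1) (neg_nonneg.2 h),
        mul_nonneg hpos.le (neg_nonneg.2 h)]
    · rw [hg3 t h]
      nlinarith [mul_nonneg (sub_nonneg.2 hjm') (sub_nonneg.2 hjm1),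
        mul_nonneg (sub_nonneg.2 hjm') (sub_nonneg.2 h),
        mul_nonneg (sub_nonneg.2 hjm1) (sub_nonneg.2 h)]
    · rcases lt_trichotomy i j with hij | rfl | hij
      · have h1 := ht.2.trans (hmono (i + 1) j (by omega) hij hjm.le)
        have h2 := h1.trans (humono j hj hjm).le
        nlinarith [hsq i hi him t ht, mul_nonneg (sub_nonneg.2 h1) (sub_nonneg.2 h2)]
      · exact (hg2 i hi him t ht).ge
      · have h1 := (hmono (j + 1) i (by omega) hij him.le).trans ht.1
        have h2 := (humono j hj hjm).le.trans h1
        nlinarith [hsq i hi him t ht, mul_nonneg (sub_nonneg.2 h1) (sub_nonneg.2 h2)]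
  have hnode : ∀ i, 1 ≤ i → i ≤ m → g (u i) = u i ^ 2 / 2 := by
    intro i hi him
    rcases him.eq_or_lt with rfl | h
    · rw [hg3 _ le_rfl]
      ring
    · rw [hg2 i hi h _ ⟨le_rfl, (humono i hi h).le⟩]
      ring
  have h0 : g 0 = 0 := by simpa using hg1 0 le_rfl
  refine ⟨fun t ht => ?_, ?_, fun i hi him t ht => ?_, fun i hi him => ?_, ?_, fun t ht => ?_⟩
  · have hgt := hg1 t ht.le
    have hmin : ∀ x, g t + -(u m) * (x - t) ≤ g x := fun x => by linarith [hleft x]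
    rw [← Set.Icc_self]
    refine subgrad_eq_Icc (c := t - 1) (d := 0) (by linarith) ht ?_ ?_ hmin hmin
    · rw [hgt, hg1 _ (by linarith)]
      ring
    · rw [hgt, h0]
      ring
  · have h12 := humono 1 le_rfl (by omega)
    have hm1 := hmid 1 le_rfl (by omega)
    have hn2 := hnode 2 (by omega) hm
    simp only [Nat.reduceAdd, hu1, zero_add, zero_mul, sub_zero] at h12 hm1 ⊢
    refine subgrad_eq_Icc (c := -1) (d := u 2) (by norm_num) h12 ?_ ?_ (fun x => ?_) (fun x => ?_)
    · rw [h0, hg1 _ (by norm_num)]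
      ring
    · rw [h0, hn2]
      ring
    · linarith [hleft x]
    · linarith [hm1 x]
  · have hgt := hg2 i hi him t ⟨ht.1.le, ht.2.le⟩
    have hmin : ∀ x, g t + (u i + u (i + 1)) / 2 * (x - t) ≤ g x :=
      fun x => by linarith [hmid i hi him x]
    rw [← Set.Icc_self]
    refine subgrad_eq_Icc ht.1 ht.2 ?_ ?_ hmin hmin
    · rw [hgt, hnode i hi him.le]
      ring
    · rw [hgt, hnode (i + 1) (by omega) him]
      ring
  · obtain ⟨k, rfl⟩ : ∃ k, i = k + 1 := ⟨i - 1, by omega⟩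
    rw [Nat.add_sub_cancel]
    have hn := hnode (k + 1) (by omega) him.le
    refine subgrad_eq_Icc (humono k (by omega) (by omega)) (humono (k + 1) (by omega) him)
      ?_ ?_ (fun x => ?_) (fun x => ?_)
    · rw [hn, hnode k (by omega) (by omega)]
      ring
    · rw [hn, hnode (k + 1 + 1) (by omega) him]
      ring
    · linarith [hmid k (by omega) (by omega) x]
    · linarith [hmid (k + 1) (by omega) him x]
  · obtain ⟨k, rfl⟩ : ∃ k, m = k + 1 := ⟨m - 1, by omega⟩
    rw [Nat.add_sub_cancel]
    have hn := hnode (k + 1) (by omega) le_rfl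
    refine subgrad_eq_Icc (d := u (k + 1) + 1) (humono k (by omega) (by omega)) (by linarith)
      ?_ ?_ (fun x => ?_) (fun x => ?_)
    · rw [hn, hnode k (by omega) (by omega)]
      ring
    · rw [hn, hg3 _ (by linarith)]
      ring
    · linarith [hmid k (by omega) (by omega) x]
    · linarith [hright x]
  · have hgt := hg3 t ht.le
    have hmin : ∀ x, g t + u m * (x - t) ≤ g x := fun x => by linarith [hright x]
    rw [← Set.Icc_self]
    refine subgrad_eq_Icc (d := t + 1) ht (by linarith) ?_ ?_ hmin hmin
    · rw [hgt, hnode m (by omega) le_rfl]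
      ring
    · rw [hgt, hg3 _ (by linarith)]
      ring
end

section
/- The subdifferential of the Fenchel conjugate of the multi-bang integrand g is characterized by inverting ∂g: for every s ∈ ℝ, the set {t ∈ ℝ : s ∈ ∂g(t)} equals (−∞, 0] if s = −u_m; {0} if s ∈ (−u_m, ½(u_1+u_2)); [u_i, u_{i+1}] if s = ½(u_i+u_{i+1}) for some 1 ≤ i < m; {u_i} if s ∈ (½(u_{i−1}+u_i), ½(u_i+u_{i+1})) for some 1 < i < m; {u_m} if s ∈ (½(u_{m−1}+u_m), u_m); [u_m, ∞) if s = u_m; and the empty set if |s| > u_m. -/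
/-- If `f` lies above the affine function with slope `s`, touching it exactly on the nonempty set
`A`, then `A` is the set of points at which `s` is a subgradient of `f`. -/
lemma setOf_mem_subgrad_eq {f : ℝ → ℝ} {s c : ℝ} {A : Set ℝ} (hne : A.Nonempty)
    (heq : ∀ t ∈ A, f t = s * t + c) (hlt : ∀ t ∉ A, s * t + c < f t) :
    {t : ℝ | s ∈ subgrad f t} = A := by
  ext t
  constructor
  · intro h
    by_contra ht
    obtain ⟨a, ha⟩ := hne
    linarith [h a, heq a ha, hlt t ht]
  · intro ht t'
    rw [heq t ht]
    by_cases h : t' ∈ A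
    · linarith [heq t' h]
    · linarith [hlt t' h]

/-- If the graph of `f` has two supporting lines at `v` with slopes `a < b`, then every slope
strictly in between is a subgradient of `f` at `v` only. -/
lemma setOf_mem_subgrad_eq_singleton {f : ℝ → ℝ} {a b s v : ℝ}
    (ha : a ∈ subgrad f v) (hb : b ∈ subgrad f v) (has : a < s) (hsb : s < b) :
    {t : ℝ | s ∈ subgrad f t} = {v} := by
  refine setOf_mem_subgrad_eq (c := f v - s * v) (Set.singleton_nonempty v) ?_ ?_
  · rintro t rfl
    ring
  · intro t ht
    rcases lt_or_gt_of_ne (show t ≠ v from ht) with h | h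
    · nlinarith [ha t, mul_pos (sub_pos.2 h) (sub_pos.2 has)]
    · nlinarith [hb t, mul_pos (sub_pos.2 h) (sub_pos.2 hsb)]

/-- The piecewise linear interpolation of `t ^ 2 / 2` lies above `t ^ 2 / 2`. -/
lemma sq_div_two_le_of_interpolation {m : ℕ} {u : ℕ → ℝ} {g : ℝ → ℝ}
    (hg : ∀ i, 1 ≤ i → i < m → ∀ t ∈ Set.Icc (u i) (u (i + 1)),
      g t = ((u i + u (i + 1)) * t - u i * u (i + 1)) / 2)
    (hm : 2 ≤ m) {t : ℝ} (h1 : u 1 ≤ t) (htm : t ≤ u m) : t ^ 2 / 2 ≤ g t := by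
  have chord : ∀ i, 1 ≤ i → i < m → u i ≤ t → t ≤ u (i + 1) → t ^ 2 / 2 ≤ g t := by
    intro i hi him hl hr
    rw [hg i hi him t ⟨hl, hr⟩]
    nlinarith [mul_nonneg (sub_nonneg.2 hl) (sub_nonneg.2 hr)]
  have key : ∀ k, 2 ≤ k → k ≤ m → t ≤ u k → t ^ 2 / 2 ≤ g t := by
    intro k hk
    induction k, hk using Nat.le_induction with
    | base => exact fun hkm htk => chord 1 le_rfl (by omega) h1 htk
    | succ k hk ih =>
      intro hkm htk
      rcases le_total t (u k) with h | h
      · exact ih (by omega) h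
      · exact chord k (by omega) (by omega) h htk
  exact key m hm le_rfl htm

/-- Characterization of the subdifferential of the Fenchel conjugate of the
multi-bang integrand `g` by inverting `∂g`: for each `s`, the set
`{t | s ∈ ∂g(t)}` is given case by case. -/
theorem multibang_conjugate_subdifferential
    (m : ℕ) (hm : 2 ≤ m) (u : ℕ → ℝ) (hu1 : u 1 = 0)
    (humono : ∀ i, 1 ≤ i → i < m → u i < u (i + 1))
    (g : ℝ → ℝ)
    (hg1 : ∀ t ≤ (0 : ℝ), g t = -(u m) * t)
    (hg2 : ∀ i, 1 ≤ i → i < m →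
      ∀ t ∈ Set.Icc (u i) (u (i + 1)),
        g t = ((u i + u (i + 1)) * t - u i * u (i + 1)) / 2)
    (hg3 : ∀ t ≥ u m, g t = u m * t - u m ^ 2 / 2) :
    ∀ s : ℝ,
      (s = -(u m) → {t : ℝ | s ∈ subgrad g t} = Set.Iic 0) ∧
      (-(u m) < s → s < (u 1 + u 2) / 2 → {t : ℝ | s ∈ subgrad g t} = {0}) ∧
      (∀ i, 1 ≤ i → i < m → s = (u i + u (i + 1)) / 2 →
        {t : ℝ | s ∈ subgrad g t} = Set.Icc (u i) (u (i + 1))) ∧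
      (∀ i, 1 < i → i < m →
        (u (i - 1) + u i) / 2 < s → s < (u i + u (i + 1)) / 2 →
        {t : ℝ | s ∈ subgrad g t} = {u i}) ∧
      ((u (m - 1) + u m) / 2 < s → s < u m → {t : ℝ | s ∈ subgrad g t} = {u m}) ∧
      (s = u m → {t : ℝ | s ∈ subgrad g t} = Set.Ici (u m)) ∧
      (u m < |s| → {t : ℝ | s ∈ subgrad g t} = ∅) := by
  have hmono : StrictMonoOn u (Set.Icc 1 m) :=
    strictMonoOn_of_lt_add_one Set.ordConnected_Icc
      fun i _ hi hi' => humono i hi.1 (Nat.lt_of_succ_le hi'.2)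
  have hle : ∀ i j, 1 ≤ i → i ≤ j → j ≤ m → u i ≤ u j := fun i j hi hij hj =>
    hmono.monotoneOn ⟨hi, hij.trans hj⟩ ⟨hi.trans hij, hj⟩ hij
  have hpos : 0 < u m := by
    rw [← hu1]
    exact hmono ⟨le_rfl, by omega⟩ ⟨by omega, le_rfl⟩ (by omega)
  have hsq : ∀ t, 0 ≤ t → t ≤ u m → t ^ 2 / 2 ≤ g t := fun t h0 htm =>
    sq_div_two_le_of_interpolation hg2 hm (hu1 ▸ h0) htm
  have left_lt : ∀ t, 0 < t → -(u m) * t < g t := by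
    intro t ht
    rcases le_total t (u m) with h | h
    · nlinarith [hsq t ht.le h]
    · rw [hg3 t h]
      nlinarith
  have left_le : ∀ t, -(u m) * t ≤ g t := fun t =>
    (le_or_gt t 0).elim (fun h => (hg1 t h).ge) fun h => (left_lt t h).le
  have right_lt : ∀ t, t < u m → u m * t - u m ^ 2 / 2 < g t := by
    intro t ht
    rcases le_total 0 t with h | h
    · nlinarith [hsq t h ht.le, mul_pos (sub_pos.2 ht) (sub_pos.2 ht)]
    · rw [hg1 t h]
      nlinarith
  have right_le : ∀ t, u m * t - u m ^ 2 / 2 ≤ g t := fun t =>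
    (le_or_gt (u m) t).elim (fun h => (hg3 t h).ge) fun h => (right_lt t h).le
  have chord_lt : ∀ i, 1 ≤ i → i < m → ∀ t ∉ Set.Icc (u i) (u (i + 1)),
      ((u i + u (i + 1)) * t - u i * u (i + 1)) / 2 < g t := by
    intro i hi him t ht
    have h0 : 0 ≤ u i := hu1 ▸ hle 1 i le_rfl hi him.le
    have h1 := humono i hi him
    have h2 := hle (i + 1) m (by omega) him le_rfl
    have hout : 0 < (t - u i) * (t - u (i + 1)) := by
      rcases lt_or_ge t (u i) with h | h
      · exact mul_pos_of_neg_of_neg (by linarith) (by linarith)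
      · have h' : u (i + 1) < t := lt_of_not_ge fun h' => ht ⟨h, h'⟩
        exact mul_pos (by linarith) (by linarith)
    rcases lt_or_ge t 0 with h | h
    · rw [hg1 t h.le]
      nlinarith [mul_nonneg h0 (h0.trans h1.le)]
    rcases le_or_gt t (u m) with h' | h'
    · nlinarith [hsq t h h']
    · rw [hg3 t h'.le]
      nlinarith [mul_nonneg (sub_nonneg.2 (h1.le.trans h2)) (sub_nonneg.2 h2),
        mul_pos (sub_pos.2 h') (show 0 < u m - (u i + u (i + 1)) / 2 by linarith)]
  have chord_le : ∀ i, 1 ≤ i → i < m → ∀ t,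
      ((u i + u (i + 1)) * t - u i * u (i + 1)) / 2 ≤ g t := by
    intro i hi him t
    by_cases h : t ∈ Set.Icc (u i) (u (i + 1))
    · exact (hg2 i hi him t h).ge
    · exact (chord_lt i hi him t h).le
  have node : ∀ i, 1 ≤ i → i < m → g (u i) = u i ^ 2 / 2 := by
    intro i hi him
    rw [hg2 i hi him (u i) ⟨le_rfl, (humono i hi him).le⟩]
    ring
  have node_last : g (u m) = u m ^ 2 / 2 := by
    rw [hg3 (u m) le_rfl]
    ring
  have chord_mem_left : ∀ i, 1 ≤ i → i < m → (u i + u (i + 1)) / 2 ∈ subgrad g (u i) := by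
    intro i hi him t
    rw [node i hi him]
    linarith [chord_le i hi him t]
  have chord_mem_right : ∀ i, 1 ≤ i → i < m →
      (u i + u (i + 1)) / 2 ∈ subgrad g (u (i + 1)) := by
    intro i hi him t
    rw [hg2 i hi him (u (i + 1)) ⟨(humono i hi him).le, le_rfl⟩]
    linarith [chord_le i hi him t]
  have left_mem : -(u m) ∈ subgrad g (u 1) := by
    intro t
    rw [hu1, hg1 0 le_rfl]
    linarith [left_le t]
  have right_mem : u m ∈ subgrad g (u m) := by
    intro t
    rw [node_last]
    linarith [right_le t]
  intro s
  refine ⟨?_, ?_, ?_, ?_, ?_, ?_, ?_⟩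
  · rintro rfl
    exact setOf_mem_subgrad_eq (c := 0) Set.nonempty_Iic
      (fun t ht => by rw [hg1 t ht, add_zero])
      (fun t ht => by linarith [left_lt t (not_le.1 ht)])
  · intro h1 h2
    rw [← hu1]
    exact setOf_mem_subgrad_eq_singleton left_mem (chord_mem_left 1 le_rfl (by omega)) h1 h2
  · rintro i hi him rfl
    exact setOf_mem_subgrad_eq (c := -(u i * u (i + 1)) / 2)
      (Set.nonempty_Icc.2 (humono i hi him).le)
      (fun t ht => by rw [hg2 i hi him t ht]; ring)
      (fun t ht => by linarith [chord_lt i hi him t ht])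
  · intro i hi him h1 h2
    have hmem := chord_mem_right (i - 1) (by omega) (by omega)
    rw [Nat.sub_add_cancel hi.le] at hmem
    exact setOf_mem_subgrad_eq_singleton hmem (chord_mem_left i hi.le him) h1 h2
  · intro h1 h2
    have hmem := chord_mem_right (m - 1) (by omega) (by omega)
    rw [Nat.sub_add_cancel (by omega)] at hmem
    exact setOf_mem_subgrad_eq_singleton hmem right_mem h1 h2
  · rintro rfl
    exact setOf_mem_subgrad_eq (c := -(u m ^ 2 / 2)) Set.nonempty_Ici
      (fun t ht => by rw [hg3 t ht]; ring)
      (fun t ht => by linarith [right_lt t (not_le.1 ht)])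
  · intro hs
    refine Set.eq_empty_of_forall_notMem fun t ht => ?_
    rcases lt_abs.1 hs with h | h
    · have h1 := le_max_left (u m) t
      have h2 := le_max_right (u m) t
      have h3 := ht (max (u m) t + 1)
      rw [hg3 (max (u m) t + 1) (by linarith)] at h3
      nlinarith [right_le t]
    · have h1 := min_le_left 0 t
      have h2 := min_le_right 0 t
      have h3 := ht (min 0 t - 1)
      rw [hg1 (min 0 t - 1) (by linarith)] at h3
      nlinarith [left_le t]
end

section
/- The smoothed projections converge uniformly to the exact projection as ε → 0⁺ with rate ε: for every ε > 0 and every t ∈ ℝ, |φ_ε(t) − φ_0(t)| ≤ ε. -/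
/-- The cubic transition profile takes values of modulus at most `ε` on `[0, ε]`. -/
lemma abs_cubic_transition_le {ε s : ℝ} (hε : 0 < ε) (hs : 0 ≤ s) (hsε : s ≤ ε) :
    |-(s ^ 3) / ε ^ 2 + s ^ 2 / ε + s| ≤ ε := by
  have lower : -(s ^ 3) / ε ^ 2 + s ^ 2 / ε + s = s ^ 2 * (ε - s) / ε ^ 2 + s := by
    field_simp
    ring
  have upper : -(s ^ 3) / ε ^ 2 + s ^ 2 / ε + s = ε - (ε - s) ^ 2 * (ε + s) / ε ^ 2 := by
    field_simp
    ring
  have hsub : 0 ≤ ε - s := sub_nonneg.2 hsε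
  have hlow : 0 ≤ s ^ 2 * (ε - s) / ε ^ 2 := by positivity
  have hupp : 0 ≤ (ε - s) ^ 2 * (ε + s) / ε ^ 2 := by positivity
  rw [abs_le]
  constructor
  · linarith
  · linarith

/-- The smoothed projections converge uniformly to the exact projection with
rate `ε`: for every `ε > 0` and every `t`, `|φ_ε(t) − φ₀(t)| ≤ ε`. -/
theorem smoothed_projection_uniform_convergence
    (umin umax C : ℝ) (h0 : 0 < umin) (h1 : umin < umax) (hC : C = umax - umin)
    (ε : ℝ) (hε : 0 < ε)
    (φ : ℝ → ℝ)
    (hφ1 : ∀ t ≤ -ε, φ t = umin + (-ε))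
    (hφ2 : ∀ t ∈ Set.Icc (-ε) 0, φ t = umin + (-(t ^ 3) / ε ^ 2 - t ^ 2 / ε + t))
    (hφ3 : ∀ t ∈ Set.Icc 0 C, φ t = umin + t)
    (hφ4 : ∀ t ∈ Set.Icc C (C + ε), φ t = umin +
      (-(t ^ 3) / ε ^ 2 + ((3 * C + ε) / ε ^ 2) * t ^ 2 +
        ((ε ^ 2 - 2 * C * ε - 3 * C ^ 2) / ε ^ 2) * t + (C ^ 3 + C ^ 2 * ε) / ε ^ 2))
    (hφ5 : ∀ t ≥ C + ε, φ t = umin + (C + ε)) :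
    ∀ t : ℝ, |φ t - (umin + min (max t 0) C)| ≤ ε := by
  intro t
  have hC0 : 0 < C := by linarith
  rcases le_total t 0 with ht | ht
  · rw [max_eq_right ht, min_eq_left hC0.le]
    rcases le_total t (-ε) with htε | htε
    · rw [hφ1 t htε, show umin + -ε - (umin + 0) = -ε by ring, abs_neg, abs_of_pos hε]
    · rw [hφ2 t ⟨htε, ht⟩, ← abs_neg]
      convert abs_cubic_transition_le hε (neg_nonneg.2 ht) (neg_le.1 htε) using 2
      ring
  · rw [max_eq_left ht]
    rcases le_total t C with htC | htC
    · rw [min_eq_left htC, hφ3 t ⟨ht, htC⟩, sub_self, abs_zero]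
      exact hε.le
    · rw [min_eq_right htC]
      rcases le_total t (C + ε) with htε | htε
      · rw [hφ4 t ⟨htC, htε⟩]
        convert abs_cubic_transition_le hε (sub_nonneg.2 htC) (sub_le_iff_le_add'.2 htε) using 2
        field_simp
        ring
      · rw [hφ5 t htε, show umin + (C + ε) - (umin + C) = ε by ring, abs_of_pos hε]
end

section
/- Truncation strictly decreases the multi-bang penalty outside the truncation interval: for every ε ≥ 0 and every t ∈ ℝ, g(min(max(t, −ε), u_m + ε)) ≤ g(t), and the inequality is strict if and only if t ∉ [−ε, u_m + ε]. -/
/-- Truncation to `[−ε, u_m + ε]` decreases the multi-bang penalty, strictly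
exactly outside the truncation interval. -/
theorem multibang_truncation_decreases
    (m : ℕ) (hm : 2 ≤ m) (u : ℕ → ℝ) (hu1 : u 1 = 0)
    (humono : ∀ i, 1 ≤ i → i < m → u i < u (i + 1))
    (g : ℝ → ℝ)
    (hg1 : ∀ t ≤ (0 : ℝ), g t = -(u m) * t)
    (hg2 : ∀ i, 1 ≤ i → i < m →
      ∀ t ∈ Set.Icc (u i) (u (i + 1)),
        g t = ((u i + u (i + 1)) * t - u i * u (i + 1)) / 2)
    (hg3 : ∀ t ≥ u m, g t = u m * t - u m ^ 2 / 2) :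
    ∀ ε : ℝ, 0 ≤ ε → ∀ t : ℝ,
      g (min (max t (-ε)) (u m + ε)) ≤ g t ∧
      (g (min (max t (-ε)) (u m + ε)) < g t ↔ t ∉ Set.Icc (-ε) (u m + ε)) := by
  have hpos : 0 < u m := by
    have key : ∀ n, 2 ≤ n → n ≤ m → 0 < u n := by
      intro n hn
      induction n, hn using Nat.le_induction with
      | base => exact fun h => hu1 ▸ humono 1 le_rfl h
      | succ k hk ih => exact fun h => (ih (by omega)).trans (humono k (by omega) h)
    exact key m hm le_rfl
  intro ε hε t
  by_cases ht : t ∈ Set.Icc (-ε) (u m + ε)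
  · rw [max_eq_left ht.1, min_eq_left ht.2]
    simp [ht.1, ht.2]
  · suffices h : g (min (max t (-ε)) (u m + ε)) < g t from ⟨h.le, fun _ => ht, fun _ => h⟩
    rcases lt_or_ge t (-ε) with hlt | hge
    · rw [max_eq_right hlt.le, min_eq_left (by linarith), hg1 (-ε) (by linarith),
        hg1 t (by linarith)]
      nlinarith
    · have hgt : u m + ε < t := not_le.mp fun h => ht ⟨hge, h⟩
      rw [max_eq_left hge, min_eq_right hgt.le, hg3 (u m + ε) (by linarith),
        hg3 t (by linarith)]
      nlinarith
end

section
/- The explicit formula for the Moreau–Yosida regularization of the conjugate multi-bang subdifferential is correct: let γ > 0 and define p_γ : ℝ → ℝ by p_γ(s) = u_1 for s ≤ (γ+½)u_1 + ½u_2; p_γ(s) = (1/γ)(s − ½(u_i + u_{i+1})) for s ∈ [(γ+½)u_i + ½u_{i+1}, ½u_i + (γ+½)u_{i+1}] (1 ≤ i < m); p_γ(s) = u_i for s ∈ [½u_{i−1} + (γ+½)u_i, (γ+½)u_i + ½u_{i+1}] (1 < i < m); and p_γ(s) = u_m for s ≥ ½u_{m−1} + (γ+½)u_m. Then p_γ is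 well defined on all of ℝ, takes values in [u_1, u_m], and for every s ∈ ℝ the number s − γ·p_γ(s) is a subgradient of ĝ at p_γ(s) relative to [u_1, u_m]; that is, ĝ(t) ≥ ĝ(p_γ(s)) + (s − γ·p_γ(s))·(t − p_γ(s)) for all t ∈ [u_1, u_m]. -/
/-- `x` solves the resolvent inclusion `s ∈ γ x + ∂g(x)`, with the subdifferential of `g` taken
relative to `[a, b]`. -/
def IsResolventPoint (g : ℝ → ℝ) (a b γ s x : ℝ) : Prop :=
  x ∈ Set.Icc a b ∧ ∀ t ∈ Set.Icc a b, g x + (s - γ * x) * (t - x) ≤ g t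

theorem IsResolventPoint.unique {g : ℝ → ℝ} {a b γ s x y : ℝ} (hγ : 0 < γ)
    (hx : IsResolventPoint g a b γ s x) (hy : IsResolventPoint g a b γ s y) : x = y := by
  have hxy := hx.2 y hy.1
  have hyx := hy.2 x hx.1
  have hsq : γ * (x - y) ^ 2 ≤ 0 := by nlinarith
  have hzero : (x - y) ^ 2 = 0 :=
    le_antisymm (nonpos_of_mul_nonpos_right hsq hγ) (sq_nonneg _)
  exact sub_eq_zero.mp (pow_eq_zero_iff two_ne_zero |>.mp hzero)

section Breakpoints

variable {m : ℕ} {u : ℕ → ℝ}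

theorem breakpoints_le_of_le (humono : ∀ i, 1 ≤ i → i < m → u i < u (i + 1)) {i j : ℕ}
    (hi : 1 ≤ i) (hij : i ≤ j) (hj : j ≤ m) : u i ≤ u j := by
  induction j, hij using Nat.le_induction with
  | base => exact le_rfl
  | succ k hik ih => exact (ih (by omega)).trans (humono k (by omega) (by omega)).le

theorem exists_mem_Icc_breakpoints {n : ℕ} (hn : 1 ≤ n) {t : ℝ}
    (ht : t ∈ Set.Icc (u 1) (u (n + 1))) :
    ∃ i, 1 ≤ i ∧ i ≤ n ∧ t ∈ Set.Icc (u i) (u (i + 1)) := by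
  induction n, hn using Nat.le_induction with
  | base => exact ⟨1, le_rfl, le_rfl, ht⟩
  | succ k hk ih =>
    rcases le_total t (u (k + 1)) with h | h
    · obtain ⟨i, hi, hik, hti⟩ := ih ⟨ht.1, h⟩
      exact ⟨i, hi, by omega, hti⟩
    · exact ⟨k + 1, by omega, le_rfl, h, ht.2⟩

variable {ghat : ℝ → ℝ}

/-- The piecewise affine interpolant of `t ↦ t² / 2` dominates the affine extension of each of its
pieces. -/
theorem chord_le_interpolant (hm : 2 ≤ m) (humono : ∀ i, 1 ≤ i → i < m → u i < u (i + 1))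
    (hghat : ∀ i, 1 ≤ i → i < m → ∀ t ∈ Set.Icc (u i) (u (i + 1)),
      ghat t = ((u i + u (i + 1)) * t - u i * u (i + 1)) / 2)
    {j : ℕ} (hj : 1 ≤ j) (hjm : j < m) {t : ℝ} (ht : t ∈ Set.Icc (u 1) (u m)) :
    ((u j + u (j + 1)) * t - u j * u (j + 1)) / 2 ≤ ghat t := by
  obtain ⟨i, hi, him, hti⟩ := exists_mem_Icc_breakpoints (u := u) (n := m - 1) (by omega)
    (by rwa [Nat.sub_add_cancel (by omega)])
  rw [hghat i hi (by omega) t hti]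
  have hprod : (t - u i) * (t - u (i + 1)) ≤ 0 :=
    mul_nonpos_of_nonneg_of_nonpos (sub_nonneg.2 hti.1) (sub_nonpos.2 hti.2)
  rcases lt_trichotomy i j with hij | rfl | hij
  · have hle := breakpoints_le_of_le humono (i := i + 1) (by omega) hij hjm.le
    have hstep := humono j hj hjm
    have htb := hti.2
    nlinarith [mul_nonneg (show 0 ≤ u j - t by linarith) (show 0 ≤ u (j + 1) - t by linarith)]
  · exact le_rfl
  · have hle := breakpoints_le_of_le humono (i := j + 1) (by omega) hij (by omega)
    have hstep := humono j hj hjm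
    have htb := hti.1
    nlinarith [mul_nonneg (show 0 ≤ t - u j by linarith) (show 0 ≤ t - u (j + 1) by linarith)]

variable {γ s : ℝ}

theorem isResolventPoint_first (hm : 2 ≤ m)
    (humono : ∀ i, 1 ≤ i → i < m → u i < u (i + 1))
    (hghat : ∀ i, 1 ≤ i → i < m → ∀ t ∈ Set.Icc (u i) (u (i + 1)),
      ghat t = ((u i + u (i + 1)) * t - u i * u (i + 1)) / 2)
    (hs : s ≤ (γ + 1 / 2) * u 1 + u 2 / 2) :
    IsResolventPoint ghat (u 1) (u m) γ s (u 1) := by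
  refine ⟨⟨le_rfl, breakpoints_le_of_le humono le_rfl (by omega) le_rfl⟩, fun t ht => ?_⟩
  have hchord := chord_le_interpolant hm humono hghat le_rfl (by omega) ht
  rw [hghat 1 le_rfl (by omega) (u 1) ⟨le_rfl, (humono 1 le_rfl (by omega)).le⟩]
  norm_num at hchord ⊢
  nlinarith [mul_nonneg (sub_nonneg.2 hs) (sub_nonneg.2 ht.1)]

theorem isResolventPoint_chord (hm : 2 ≤ m) (hγ : 0 < γ)
    (humono : ∀ i, 1 ≤ i → i < m → u i < u (i + 1))
    (hghat : ∀ i, 1 ≤ i → i < m → ∀ t ∈ Set.Icc (u i) (u (i + 1)),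
      ghat t = ((u i + u (i + 1)) * t - u i * u (i + 1)) / 2)
    {i : ℕ} (hi : 1 ≤ i) (him : i < m)
    (hs : s ∈ Set.Icc ((γ + 1 / 2) * u i + u (i + 1) / 2)
      (u i / 2 + (γ + 1 / 2) * u (i + 1))) :
    IsResolventPoint ghat (u 1) (u m) γ s ((1 / γ) * (s - (u i + u (i + 1)) / 2)) := by
  obtain ⟨hs₁, hs₂⟩ := hs
  set x := (1 / γ) * (s - (u i + u (i + 1)) / 2) with hx
  have hγx : γ * x = s - (u i + u (i + 1)) / 2 := by rw [hx]; field_simp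
  have hix : u i ≤ x := le_of_mul_le_mul_left (by linarith) hγ
  have hxi : x ≤ u (i + 1) := le_of_mul_le_mul_left (by linarith) hγ
  refine ⟨⟨(breakpoints_le_of_le humono le_rfl hi him.le).trans hix,
    hxi.trans (breakpoints_le_of_le humono (by omega) him le_rfl)⟩, fun t ht => ?_⟩
  have hchord := chord_le_interpolant hm humono hghat hi him ht
  rw [hghat i hi him x ⟨hix, hxi⟩, hγx]
  linarith

theorem isResolventPoint_kink (hm : 2 ≤ m)
    (humono : ∀ i, 1 ≤ i → i < m → u i < u (i + 1))
    (hghat : ∀ i, 1 ≤ i → i < m → ∀ t ∈ Set.Icc (u i) (u (i + 1)),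
      ghat t = ((u i + u (i + 1)) * t - u i * u (i + 1)) / 2)
    {i : ℕ} (hi : 1 < i) (him : i < m)
    (hs : s ∈ Set.Icc (u (i - 1) / 2 + (γ + 1 / 2) * u i)
      ((γ + 1 / 2) * u i + u (i + 1) / 2)) :
    IsResolventPoint ghat (u 1) (u m) γ s (u i) := by
  refine ⟨⟨breakpoints_le_of_le humono le_rfl hi.le him.le,
    breakpoints_le_of_le humono hi.le him.le le_rfl⟩, fun t ht => ?_⟩
  have hright := chord_le_interpolant hm humono hghat hi.le him ht
  have hleft := chord_le_interpolant hm humono hghat (j := i - 1) (by omega) (by omega) ht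
  rw [Nat.sub_add_cancel hi.le] at hleft
  rw [hghat i hi.le him (u i) ⟨le_rfl, (humono i hi.le him).le⟩]
  rcases le_total t (u i) with h | h
  · nlinarith [mul_nonneg (sub_nonneg.2 hs.1) (sub_nonneg.2 h)]
  · nlinarith [mul_nonneg (sub_nonneg.2 hs.2) (sub_nonneg.2 h)]

theorem isResolventPoint_last (hm : 2 ≤ m)
    (humono : ∀ i, 1 ≤ i → i < m → u i < u (i + 1))
    (hghat : ∀ i, 1 ≤ i → i < m → ∀ t ∈ Set.Icc (u i) (u (i + 1)),
      ghat t = ((u i + u (i + 1)) * t - u i * u (i + 1)) / 2)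
    (hs : u (m - 1) / 2 + (γ + 1 / 2) * u m ≤ s) :
    IsResolventPoint ghat (u 1) (u m) γ s (u m) := by
  have hpred : m - 1 + 1 = m := by omega
  refine ⟨⟨breakpoints_le_of_le humono le_rfl (by omega) le_rfl, le_rfl⟩, fun t ht => ?_⟩
  have hchord := chord_le_interpolant hm humono hghat (j := m - 1) (by omega) (by omega) ht
  have hval := hghat (m - 1) (by omega) (by omega) (u m)
  have hstep := humono (m - 1) (by omega) (by omega)
  rw [hpred] at hchord hval hstep
  rw [hval ⟨hstep.le, le_rfl⟩]
  nlinarith [mul_nonneg (sub_nonneg.2 hs) (sub_nonneg.2 ht.2)]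

theorem exists_isResolventPoint (hm : 2 ≤ m) (hγ : 0 < γ)
    (humono : ∀ i, 1 ≤ i → i < m → u i < u (i + 1))
    (hghat : ∀ i, 1 ≤ i → i < m → ∀ t ∈ Set.Icc (u i) (u (i + 1)),
      ghat t = ((u i + u (i + 1)) * t - u i * u (i + 1)) / 2) (s : ℝ) :
    ∃ x, IsResolventPoint ghat (u 1) (u m) γ s x := by
  have hbelow : ∀ k, 1 ≤ k → k < m → s ≤ u k / 2 + (γ + 1 / 2) * u (k + 1) →
      ∃ x, IsResolventPoint ghat (u 1) (u m) γ s x := by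
    intro k hk
    induction k, hk using Nat.le_induction with
    | base =>
      intro hkm hs
      rcases le_total s ((γ + 1 / 2) * u 1 + u 2 / 2) with h | h
      · exact ⟨_, isResolventPoint_first hm humono hghat h⟩
      · exact ⟨_, isResolventPoint_chord hm hγ humono hghat le_rfl hkm ⟨h, hs⟩⟩
    | succ k hk ih =>
      intro hkm hs
      rcases le_total s (u k / 2 + (γ + 1 / 2) * u (k + 1)) with h | h
      · exact ih (by omega) h
      rcases le_total s ((γ + 1 / 2) * u (k + 1) + u (k + 1 + 1) / 2) with hmid | hmid
      · exact ⟨_, isResolventPoint_kink hm humono hghat (i := k + 1) (by omega) hkm ⟨h, hmid⟩⟩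
      · exact ⟨_, isResolventPoint_chord hm hγ humono hghat (by omega) hkm ⟨hmid, hs⟩⟩
  rcases le_total s (u (m - 1) / 2 + (γ + 1 / 2) * u m) with h | h
  · refine hbelow (m - 1) (by omega) (by omega) ?_
    rwa [Nat.sub_add_cancel (by omega)]
  · exact ⟨_, isResolventPoint_last hm humono hghat h⟩

end Breakpoints

/-- The explicit formula for the Moreau–Yosida regularization of the conjugate
multi-bang subdifferential is correct: there is a well-defined function `p_γ`
on all of `ℝ` satisfying the stated piecewise formulas, taking values in
`[u₁, u_m]`, and such that `s − γ·p_γ(s)` is a subgradient of `ĝ` at `p_γ(s)`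
relative to `[u₁, u_m]`. -/
theorem moreau_yosida_multibang_formula
    (m : ℕ) (hm : 2 ≤ m) (u : ℕ → ℝ) (hu1 : u 1 = 0)
    (humono : ∀ i, 1 ≤ i → i < m → u i < u (i + 1))
    (γ : ℝ) (hγ : 0 < γ)
    (ghat : ℝ → ℝ)
    (hghat : ∀ i, 1 ≤ i → i < m →
      ∀ t ∈ Set.Icc (u i) (u (i + 1)),
        ghat t = ((u i + u (i + 1)) * t - u i * u (i + 1)) / 2) :
    ∃ p : ℝ → ℝ,
      (∀ s ≤ (γ + 1 / 2) * u 1 + u 2 / 2, p s = u 1) ∧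
      (∀ i, 1 ≤ i → i < m →
        ∀ s ∈ Set.Icc ((γ + 1 / 2) * u i + u (i + 1) / 2)
            (u i / 2 + (γ + 1 / 2) * u (i + 1)),
          p s = (1 / γ) * (s - (u i + u (i + 1)) / 2)) ∧
      (∀ i, 1 < i → i < m →
        ∀ s ∈ Set.Icc (u (i - 1) / 2 + (γ + 1 / 2) * u i)
            ((γ + 1 / 2) * u i + u (i + 1) / 2),
          p s = u i) ∧
      (∀ s ≥ u (m - 1) / 2 + (γ + 1 / 2) * u m, p s = u m) ∧
      (∀ s : ℝ, p s ∈ Set.Icc (u 1) (u m)) ∧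
      (∀ s : ℝ, ∀ t ∈ Set.Icc (u 1) (u m),
        ghat (p s) + (s - γ * p s) * (t - p s) ≤ ghat t) := by
  choose p hp using exists_isResolventPoint hm hγ humono hghat
  exact ⟨p,
    fun s hs => (hp s).unique hγ (isResolventPoint_first hm humono hghat hs),
    fun i hi him s hs => (hp s).unique hγ (isResolventPoint_chord hm hγ humono hghat hi him hs),
    fun i hi him s hs => (hp s).unique hγ (isResolventPoint_kink hm humono hghat hi him hs),
    fun s hs => (hp s).unique hγ (isResolventPoint_last hm humono hghat hs),
    fun s => (hp s).1, fun s => (hp s).2⟩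
end
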